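/- If Y is a p-connected topological space and Z is a q-connected topological space (with p, q ≥ 0, and both nonempty), then the join Y ∗ Z is (p + q + 2)-connected. -/

import Mathlib

open unitInterval

/-- The join relation on `Y × Z × [0,1]`: identify `(y, z, 0) ∼ (y, z′, 0)`
and `(y, z, 1) ∼ (y′, z, 1)`. -/
def JoinRel (Y Z : Type*) (a b : Y × Z × I) : Prop :=
  (a.2.2 = 0 ∧ b.2.2 = 0 ∧ a.1 = b.1) ∨ (a.2.2 = 1 ∧ b.2.2 = 1 ∧ a.2.1 = b.2.1)

/-- The topological join `Y ∗ Z`, as the quotient of `Y × Z × [0,1]` by the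
join relation, with the quotient topology. -/
def Join (Y Z : Type*) [TopologicalSpace Y] [TopologicalSpace Z] : Type _ :=
  Quot (JoinRel Y Z)

noncomputable instance (Y Z : Type*) [TopologicalSpace Y] [TopologicalSpace Z] :
    TopologicalSpace (Join Y Z) :=
  instTopologicalSpaceQuot

/-- A space is `n`-connected if it is path-connected and its homotopy groups
`π_k` vanish for `1 ≤ k ≤ n`. -/
def NConnected (n : ℕ) (X : Type*) [TopologicalSpace X] : Prop :=
  PathConnectedSpace X ∧
    ∀ k : ℕ, 1 ≤ k → k ≤ n → ∀ x : X, Subsingleton (HomotopyGroup (Fin k) X x)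

open Set Metric Topology

section Gluing

variable {α β : Type*} [TopologicalSpace α] [TopologicalSpace β]

/-- Continuity on a set may be checked on the two pieces of a closed cover. -/
theorem ContinuousOn.of_closed_cover {f : α → β} {s C D : Set α} (hC : IsClosed C)
    (hD : IsClosed D) (hs : ∀ x ∈ s, x ∈ C ∨ x ∈ D) (h₁ : ContinuousOn f (s ∩ C))
    (h₂ : ContinuousOn f (s ∩ D)) : ContinuousOn f s := by
  intro x hx
  have key : ∀ E : Set α, IsClosed E → ContinuousOn f (s ∩ E) →
      ContinuousWithinAt f (s ∩ E) x := by
    intro E hE h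
    by_cases hxE : x ∈ E
    · exact h x ⟨hx, hxE⟩
    · refine continuousWithinAt_of_notMem_closure fun h' => hxE ?_
      exact hE.closure_subset_iff.2 inter_subset_right h'
  refine ((key C hC h₁).union (key D hD h₂)).mono fun y hy => ?_
  rcases hs y hy with h | h
  exacts [Or.inl ⟨hy, h⟩, Or.inr ⟨hy, h⟩]

end Gluing

namespace Join

variable {Y Z : Type*} [TopologicalSpace Y] [TopologicalSpace Z]

/-- The point of the join at height `t` on the segment from `y` to `z`. -/
def mk (y : Y) (z : Z) (t : I) : Join Y Z := Quot.mk _ (y, z, t)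

theorem isQuotientMap_mk :
    IsQuotientMap (fun a : Y × Z × I => (mk a.1 a.2.1 a.2.2 : Join Y Z)) :=
  isQuotientMap_quot_mk

theorem exists_eq_mk (j : Join Y Z) : ∃ y z t, j = mk y z t := by
  obtain ⟨a, rfl⟩ := isQuotientMap_mk.surjective j
  exact ⟨_, _, _, rfl⟩

theorem mk_zero (y : Y) (z z' : Z) : mk y z 0 = mk y z' 0 :=
  Quot.sound (Or.inl ⟨rfl, rfl, rfl⟩)

theorem mk_one (y y' : Y) (z : Z) : mk y z 1 = mk y' z 1 :=
  Quot.sound (Or.inr ⟨rfl, rfl, rfl⟩)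

theorem continuous_mk : Continuous (fun a : Y × Z × I => (mk a.1 a.2.1 a.2.2 : Join Y Z)) :=
  isQuotientMap_mk.continuous

/-- The join coordinate in `[0, 1]`. -/
def height : Join Y Z → I :=
  Quot.lift (fun a => a.2.2) (by rintro a b (⟨h, h', -⟩ | ⟨h, h', -⟩) <;> rw [h, h'])

@[simp] theorem height_mk (y : Y) (z : Z) (t : I) : height (mk y z t) = t := rfl

theorem continuous_height : Continuous (height : Join Y Z → I) :=
  isQuotientMap_mk.continuous_iff.2 (continuous_snd.comp continuous_snd)

/-- The `Y`-coordinate of a point of the join; meaningful below height `1`. -/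
noncomputable def left (j : Join Y Z) : Y := (Quot.out j).1

/-- The `Z`-coordinate of a point of the join; meaningful above height `0`. -/
noncomputable def right (j : Join Y Z) : Z := (Quot.out j).2.1

theorem mk_out (j : Join Y Z) : mk (left j) (right j) (height j) = j := by
  have h : Quot.mk _ (Quot.out j) = j := Quot.out_eq j
  have h' : height j = (Quot.out j).2.2 := (congrArg height h).symm
  rw [h']
  exact h

theorem eq_left_of_mk_eq {y y' : Y} {z z' : Z} {t t' : I} (h : mk y z t = mk y' z' t')
    (ht : t ≠ 1) : y = y' := by
  classical
  let F : Join Y Z → Option Y :=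
    Quot.lift (fun a => if a.2.2 = 1 then none else some a.1) (by
      rintro a b (⟨h, h', h''⟩ | ⟨h, h', -⟩) <;> simp [*])
  have h₁ : F (mk y z t) = some y := if_neg ht
  have h₂ : F (mk y' z' t') = some y' := if_neg (by
    have := congrArg height h
    simp only [height_mk] at this
    rwa [← this])
  rw [h, h₂] at h₁
  exact (Option.some.inj h₁).symm

theorem eq_right_of_mk_eq {y y' : Y} {z z' : Z} {t t' : I} (h : mk y z t = mk y' z' t')
    (ht : t ≠ 0) : z = z' := by
  classical
  let F : Join Y Z → Option Z :=
    Quot.lift (fun a => if a.2.2 = 0 then none else some a.2.1) (by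
      rintro a b (⟨h, h', -⟩ | ⟨h, h', h''⟩) <;> simp [*])
  have h₁ : F (mk y z t) = some z := if_neg ht
  have h₂ : F (mk y' z' t') = some z' := if_neg (by
    have := congrArg height h
    simp only [height_mk] at this
    rwa [← this])
  rw [h, h₂] at h₁
  exact (Option.some.inj h₁).symm

theorem left_mk (y : Y) (z : Z) {t : I} (ht : t ≠ 1) : left (mk y z t) = y :=
  (eq_left_of_mk_eq (mk_out (mk y z t)).symm ht).symm

theorem right_mk (y : Y) (z : Z) {t : I} (ht : t ≠ 0) : right (mk y z t) = z :=
  (eq_right_of_mk_eq (mk_out (mk y z t)).symm ht).symm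

theorem continuousOn_left : ContinuousOn (left : Join Y Z → Y) {j | height j ≠ 1} := by
  have hopen : IsOpen {j : Join Y Z | height j ≠ 1} :=
    isOpen_ne.preimage continuous_height
  rw [continuousOn_open_iff hopen]
  intro O hO
  rw [← isQuotientMap_mk.isOpen_preimage]
  have : (fun a : Y × Z × I => (mk a.1 a.2.1 a.2.2 : Join Y Z)) ⁻¹'
      ({j | height j ≠ 1} ∩ left ⁻¹' O) = {a | a.2.2 ≠ 1} ∩ {a | a.1 ∈ O} := by
    ext a
    simp only [mem_preimage, mem_inter_iff, mem_ofPred_eq, height_mk]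
    exact and_congr_right fun h => by rw [left_mk _ _ h]
  rw [this]
  exact (isOpen_ne.preimage (continuous_snd.comp continuous_snd)).inter
    (hO.preimage continuous_fst)

theorem continuousOn_right : ContinuousOn (right : Join Y Z → Z) {j | height j ≠ 0} := by
  have hopen : IsOpen {j : Join Y Z | height j ≠ 0} :=
    isOpen_ne.preimage continuous_height
  rw [continuousOn_open_iff hopen]
  intro O hO
  rw [← isQuotientMap_mk.isOpen_preimage]
  have : (fun a : Y × Z × I => (mk a.1 a.2.1 a.2.2 : Join Y Z)) ⁻¹'
      ({j | height j ≠ 0} ∩ right ⁻¹' O) = {a | a.2.2 ≠ 0} ∩ {a | a.2.1 ∈ O} := by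
    ext a
    simp only [mem_preimage, mem_inter_iff, mem_ofPred_eq, height_mk]
    exact and_congr_right fun h => by rw [right_mk _ _ h]
  rw [this]
  exact (isOpen_ne.preimage (continuous_snd.comp continuous_snd)).inter
    (hO.preimage (continuous_fst.comp continuous_snd))

/-- The piecewise linear self-map of the interval collapsing its outer thirds. -/
noncomputable def stretch (t : ℝ) : I := projIcc 0 1 zero_le_one (3 * t - 1)

theorem continuous_stretch : Continuous stretch :=
  continuous_projIcc.comp (by fun_prop)

theorem stretch_of_le {t : ℝ} (ht : t ≤ 1 / 3) : stretch t = 0 :=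
  projIcc_of_le_left _ (by linarith)

theorem stretch_of_ge {t : ℝ} (ht : 2 / 3 ≤ t) : stretch t = 1 :=
  projIcc_of_right_le _ (by linarith)

/-- The straight-line homotopy from `stretch` at `s = 1` to the identity at `s = 0`. -/
noncomputable def stretchHomotopy (t : I) (s : ℝ) : I :=
  projIcc 0 1 zero_le_one (t + s * (stretch t - t))

theorem stretchHomotopy_apply_zero (t : I) : stretchHomotopy t 0 = t := by
  simp [stretchHomotopy]

theorem stretchHomotopy_apply_one (t : I) : stretchHomotopy t 1 = stretch t := by
  simp [stretchHomotopy]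

theorem stretchHomotopy_zero (s : ℝ) : stretchHomotopy 0 s = 0 := by
  simp [stretchHomotopy, stretch_of_le (t := 0) (by norm_num)]

theorem stretchHomotopy_one (s : ℝ) : stretchHomotopy 1 s = 1 := by
  simp [stretchHomotopy, stretch_of_ge (t := 1) (by norm_num)]

/-- The homotopy of the join induced by `stretchHomotopy`. -/
noncomputable def stretchMap (j : Join Y Z) (s : ℝ) : Join Y Z :=
  Quot.lift (fun a : Y × Z × I => mk a.1 a.2.1 (stretchHomotopy a.2.2 s)) (by
    rintro ⟨y, z, t⟩ ⟨y', z', t'⟩ (⟨h, h', h''⟩ | ⟨h, h', h''⟩)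
    · simp only at h h' h''
      subst h h' h''
      simp only [stretchHomotopy_zero]
      exact mk_zero _ _ _
    · simp only at h h' h''
      subst h h' h''
      simp only [stretchHomotopy_one]
      exact mk_one _ _ _) j

theorem stretchMap_mk (y : Y) (z : Z) (t : I) (s : ℝ) :
    stretchMap (mk y z t) s = mk y z (stretchHomotopy t s) := rfl

theorem continuous_stretchMap :
    Continuous (fun a : Join Y Z × ℝ => stretchMap a.1 a.2) := by
  refine isQuotientMap_mk.continuous_lift_prod_left ?_
  simp only [stretchMap_mk]
  have h : Continuous fun a : (Y × Z × I) × ℝ => stretchHomotopy a.1.2.2 a.2 := by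
    unfold stretchHomotopy
    refine continuous_projIcc.comp ?_
    have := continuous_stretch
    fun_prop
  exact continuous_mk.comp (f := fun a : (Y × Z × I) × ℝ =>
    (a.1.1, a.1.2.1, stretchHomotopy a.1.2.2 a.2)) (by fun_prop)

theorem stretchMap_zero (j : Join Y Z) : stretchMap j 0 = j := by
  obtain ⟨y, z, t, rfl⟩ := exists_eq_mk j
  rw [stretchMap_mk, stretchHomotopy_apply_zero]

theorem mk_stretch_eq_stretchMap {j : Join Y Z} {y : Y} {z : Z}
    (hy : (height j : ℝ) ≤ 2 / 3 → y = left j) (hz : 1 / 3 ≤ (height j : ℝ) → z = right j) :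
    mk y z (stretch (height j)) = stretchMap j 1 := by
  have h : stretchMap j 1 = mk (left j) (right j) (stretch (height j)) := by
    conv_lhs => rw [← mk_out j]
    rw [stretchMap_mk, stretchHomotopy_apply_one]
  rw [h]
  rcases le_total (height j : ℝ) (1 / 3) with h₁ | h₁
  · rw [hy (by linarith), stretch_of_le h₁]
    exact mk_zero _ _ _
  rcases le_total (height j : ℝ) (2 / 3) with h₂ | h₂
  · rw [hy h₂, hz h₁]
  · rw [hz h₁, stretch_of_ge h₂]
    exact mk_one _ _ _

/-- A map into the join can be assembled from a height function `τ` and maps to `Y` and `Z`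
that are continuous where `τ ≤ 2 / 3` and `1 / 3 ≤ τ` respectively. -/
theorem continuousOn_mk_stretch {α : Type*} [TopologicalSpace α] {s : Set α} (hs : IsClosed s)
    {τ : α → ℝ} {f : α → Y} {g : α → Z} (hτ : ContinuousOn τ s)
    (hf : ContinuousOn f (s ∩ {x | τ x ≤ 2 / 3})) (hg : ContinuousOn g (s ∩ {x | 1 / 3 ≤ τ x})) :
    ContinuousOn (fun x => mk (f x) (g x) (stretch (τ x))) s := by
  have hle : ∀ c, IsClosed (s ∩ {x | τ x ≤ c}) := fun c =>
    hτ.preimage_isClosed_of_isClosed hs isClosed_Iic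
  have hge : ∀ c, IsClosed (s ∩ {x | c ≤ τ x}) := fun c =>
    hτ.preimage_isClosed_of_isClosed hs isClosed_Ici
  refine ContinuousOn.of_closed_cover (hle (1 / 3)) (hge (1 / 3))
    (fun x hx => (le_total (τ x) (1 / 3)).imp (⟨hx, ·⟩) (⟨hx, ·⟩)) ?_ ?_
  · rw [← inter_assoc, inter_self]
    rcases isEmpty_or_nonempty Z with hZ | ⟨⟨z⟩⟩
    · exact fun x => (hZ.false (g x)).elim
    refine ContinuousOn.congr (f := fun x => mk (f x) z 0) ?_ fun x hx => ?_
    · exact continuous_mk.comp_continuousOn (f := fun x => (f x, z, 0))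
        ((hf.mono fun x hx => ⟨hx.1, (show τ x ≤ 1 / 3 from hx.2).trans (by norm_num)⟩).prodMk
          continuousOn_const)
    · simp only [stretch_of_le hx.2]
      exact mk_zero _ _ _
  rw [← inter_assoc, inter_self]
  refine ContinuousOn.of_closed_cover (hle (2 / 3)) (hge (2 / 3))
    (fun x hx => (le_total (τ x) (2 / 3)).imp (⟨hx.1, ·⟩) (⟨hx.1, ·⟩)) ?_ ?_
  · refine continuous_mk.comp_continuousOn (f := fun x => (f x, g x, stretch (τ x)))
      ((hf.mono fun x hx => hx.2).prodMk ((hg.mono fun x hx => hx.1).prodMk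
        (continuous_stretch.comp_continuousOn (hτ.mono fun x hx => hx.1.1))))
  · rcases isEmpty_or_nonempty Y with hY | ⟨⟨y⟩⟩
    · exact fun x => (hY.false (f x)).elim
    refine ContinuousOn.congr (f := fun x => mk y (g x) 1) ?_ fun x hx => ?_
    · exact continuous_mk.comp_continuousOn (f := fun x => (y, g x, 1))
        (continuousOn_const.prodMk ((hg.mono fun x hx => hx.1).prodMk continuousOn_const))
    · simp only [stretch_of_ge hx.2.2]
      exact mk_one _ _ _

end Join

/-- Every continuous map from the boundary of the `n`-cube `[-1, 1]ⁿ` to `X` extends over the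
cube. -/
def ExtendsOver (n : ℕ) (X : Type*) [TopologicalSpace X] : Prop :=
  ∀ φ : (Fin n → ℝ) → X, ContinuousOn φ (sphere 0 1) →
    ∃ Φ : (Fin n → ℝ) → X, ContinuousOn Φ (closedBall 0 1) ∧ EqOn Φ φ (sphere 0 1)

theorem mem_closedBall_pi_iff {ι : Type*} [Fintype ι] {v : ι → ℝ} :
    v ∈ closedBall (0 : ι → ℝ) 1 ↔ ∀ k, |v k| ≤ 1 := by
  rw [mem_closedBall_zero_iff, pi_norm_le_iff_of_nonneg zero_le_one]
  rfl

theorem mem_sphere_pi_iff {ι : Type*} [Fintype ι] {v : ι → ℝ} :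
    v ∈ sphere (0 : ι → ℝ) 1 ↔ (∀ k, |v k| ≤ 1) ∧ ∃ k, |v k| = 1 := by
  rw [← mem_closedBall_pi_iff, mem_closedBall_zero_iff, mem_sphere_zero_iff_norm]
  constructor
  · intro h
    refine ⟨h.le, ?_⟩
    by_contra! hne
    refine absurd h (ne_of_lt ((pi_norm_lt_iff zero_lt_one).2 fun k => ?_))
    exact lt_of_le_of_ne ((norm_le_pi_norm v k).trans h.le) (hne k)
  · rintro ⟨h, k, hk⟩
    exact le_antisymm h (hk ▸ norm_le_pi_norm v k)

namespace CubicalGrid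

variable {ι : Type*}

/-- The smallest closed cell of the integer grid containing `x`. -/
def cell (x : ι → ℝ) : Set (ι → ℝ) :=
  {y | ∀ i, (⌊x i⌋ : ℝ) ≤ y i ∧ y i ≤ ⌈x i⌉}

/-- The barycentre of `cell x`. -/
noncomputable def center (x : ι → ℝ) : ι → ℝ := fun i => ((⌊x i⌋ + ⌈x i⌉ : ℤ) : ℝ) / 2

theorem mem_cell_self (x : ι → ℝ) : x ∈ cell x := fun _ => ⟨Int.floor_le _, Int.le_ceil _⟩

theorem cell_subset {x y : ι → ℝ} (h : y ∈ cell x) : cell y ⊆ cell x := fun _ hz i =>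
  ⟨(Int.cast_le.2 (Int.le_floor.2 (h i).1)).trans (hz i).1,
    (hz i).2.trans (Int.cast_le.2 (Int.ceil_le.2 (h i).2))⟩

theorem center_mem_cell (x : ι → ℝ) : center x ∈ cell x := fun i => by
  have h : (⌊x i⌋ : ℝ) ≤ ⌈x i⌉ := Int.cast_le.2 (Int.floor_le_ceil _)
  simp only [center, Int.cast_add]
  constructor <;> linarith

theorem abs_sub_le_of_mem_cell {x y : ι → ℝ} (h : y ∈ cell x) (i : ι) : |y i - x i| ≤ 1 := by
  have h₁ := Int.lt_floor_add_one (x i)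
  have h₂ := Int.ceil_lt_add_one (x i)
  have h₃ := h i
  rw [abs_le]
  constructor <;> linarith

theorem isClosed_cell (x : ι → ℝ) : IsClosed (cell x) := by
  have : cell x = ⋂ i, {y | (⌊x i⌋ : ℝ) ≤ y i ∧ y i ≤ (⌈x i⌉ : ℝ)} := by
    ext
    simp [cell]
  rw [this]
  exact isClosed_iInter fun i =>
    (isClosed_le continuous_const (continuous_apply i)).inter
      (isClosed_le (continuous_apply i) continuous_const)

variable [Fintype ι]

/-- The non-integral coordinates of `x`; their number is the dimension of `cell x`. -/
noncomputable def free (x : ι → ℝ) : Finset ι :=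
  letI := Classical.decPred fun i => ⌊x i⌋ ≠ ⌈x i⌉
  Finset.univ.filter fun i => ⌊x i⌋ ≠ ⌈x i⌉

theorem mem_free {x : ι → ℝ} {i : ι} : i ∈ free x ↔ ⌊x i⌋ ≠ ⌈x i⌉ := by
  simp [free]

theorem ceil_eq_of_mem_free {x : ι → ℝ} {i : ι} (h : i ∈ free x) : ⌈x i⌉ = ⌊x i⌋ + 1 :=
  le_antisymm (Int.ceil_le_floor_add_one _)
    (Int.add_one_le_iff.2 (lt_of_le_of_ne (Int.floor_le_ceil _) (mem_free.1 h)))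

theorem eq_of_notMem_free {x : ι → ℝ} {i : ι} (h : i ∉ free x) :
    (⌊x i⌋ : ℝ) = x i ∧ (⌈x i⌉ : ℝ) = x i := by
  have h' : ⌊x i⌋ = ⌈x i⌉ := by simpa [mem_free] using h
  have h₁ := Int.floor_le (x i)
  have h₂ := Int.le_ceil (x i)
  rw [← h'] at h₂ ⊢
  exact ⟨le_antisymm h₁ h₂, le_antisymm h₁ h₂⟩

theorem notMem_free_of_eq {x : ι → ℝ} {i : ι} {m : ℤ} (h : x i = m) : i ∉ free x := by
  simp [mem_free, h]

theorem free_subset {x y : ι → ℝ} (h : y ∈ cell x) : free y ⊆ free x := fun i hi => by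
  rw [mem_free] at hi ⊢
  have h₁ := Int.le_floor.2 (h i).1
  have h₂ := Int.ceil_le.2 (h i).2
  have h₃ := Int.floor_le_ceil (y i)
  omega

theorem floor_ceil_eq {x y : ι → ℝ} (h : y ∈ cell x) (hf : free x ⊆ free y) (i : ι) :
    ⌊y i⌋ = ⌊x i⌋ ∧ ⌈y i⌉ = ⌈x i⌉ := by
  have h₁ := Int.le_floor.2 (h i).1
  have h₂ := Int.ceil_le.2 (h i).2
  have h₃ := Int.floor_le_ceil (y i)
  by_cases hi : i ∈ free x
  · have h₄ := ceil_eq_of_mem_free hi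
    have h₅ := ceil_eq_of_mem_free (hf hi)
    omega
  · have h₄ : ⌊x i⌋ = ⌈x i⌉ := by simpa [mem_free] using hi
    omega

theorem cell_eq {x y : ι → ℝ} (h : y ∈ cell x) (hf : free x ⊆ free y) : cell y = cell x := by
  ext z
  exact forall_congr' fun i => by
    rw [(floor_ceil_eq h hf i).1, (floor_ceil_eq h hf i).2]

theorem center_eq {x y : ι → ℝ} (h : y ∈ cell x) (hf : free x ⊆ free y) :
    center y = center x := by
  ext i
  rw [center, center, (floor_ceil_eq h hf i).1, (floor_ceil_eq h hf i).2]

theorem free_subset_free_center (x : ι → ℝ) : free x ⊆ free (center x) := fun i hi => by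
  have h := ceil_eq_of_mem_free hi
  by_contra hc
  have h' := (eq_of_notMem_free hc).1
  have h'' : ((2 * ⌊center x i⌋ : ℤ) : ℝ) = (⌊x i⌋ + ⌈x i⌉ : ℤ) := by
    push_cast [h']
    simp only [center]
    push_cast
    ring
  have := Int.cast_injective h''
  omega

theorem cell_center (x : ι → ℝ) : cell (center x) = cell x :=
  cell_eq (center_mem_cell x) (free_subset_free_center x)

theorem locallyFinite_cell :
    LocallyFinite fun c : ι → ℤ => cell (fun i => (c i : ℝ) / 2) := by
  classical
  intro x
  refine ⟨ball x 1, ball_mem_nhds x one_pos, (finite_Icc (fun i => ⌊2 * x i⌋ - 4)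
    (fun i => ⌈2 * x i⌉ + 4)).subset ?_⟩
  rintro c ⟨y, hy, hyx⟩
  have key : ∀ i, (c i : ℝ) ≤ 2 * x i + 4 ∧ 2 * x i - 4 ≤ c i := fun i => by
    have h₁ := abs_le.1 (abs_sub_le_of_mem_cell hy i)
    have h₂ := (dist_pi_lt_iff one_pos).1 (mem_ball.1 hyx) i
    rw [Real.dist_eq, abs_lt] at h₂
    constructor <;> linarith
  refine ⟨fun i => ?_, fun i => ?_⟩
  · have h₁ := Int.floor_le (2 * x i)
    have h₂ := key i
    exact_mod_cast (by push_cast; linarith : ((⌊2 * x i⌋ - 4 : ℤ) : ℝ) ≤ c i)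
  · have h₁ := Int.le_ceil (2 * x i)
    have h₂ := key i
    exact_mod_cast (by push_cast; linarith : (c i : ℝ) ≤ ((⌈2 * x i⌉ + 4 : ℤ) : ℝ))

variable {X : Type*} [TopologicalSpace X]

theorem exists_extension_cell {j : ℕ} (hX : ExtendsOver j X) {x : ι → ℝ}
    (hx : (free x).card = j) {g : (ι → ℝ) → X}
    (hg : ContinuousOn g (cell x ∩ {y | (free y).card < j})) :
    ∃ h : (ι → ℝ) → X, ContinuousOn h (cell x) ∧
      EqOn h g (cell x ∩ {y | (free y).card < j}) := by
  classical
  let e : free x ≃ Fin j := Fintype.equivFinOfCardEq (by simpa using hx)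
  let emb : (Fin j → ℝ) → ι → ℝ := fun v i =>
    if hi : i ∈ free x then ⌊x i⌋ + (v (e ⟨i, hi⟩) + 1) / 2 else x i
  let proj : (ι → ℝ) → Fin j → ℝ := fun y k => 2 * (y (e.symm k) - ⌊x (e.symm k)⌋) - 1
  have emb_cont : Continuous emb := continuous_pi fun i => by
    by_cases hi : i ∈ free x
    · simp only [emb, dif_pos hi]
      fun_prop
    · simp only [emb, dif_neg hi]
      fun_prop
  have proj_cont : Continuous proj := by fun_prop
  have emb_proj : ∀ y ∈ cell x, emb (proj y) = y := fun y hy => by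
    ext i
    by_cases hi : i ∈ free x
    · simp only [emb, proj, dif_pos hi, Equiv.symm_apply_apply]
      ring
    · have h₁ := eq_of_notMem_free hi
      have h₂ := hy i
      simp only [emb, dif_neg hi]
      rw [h₁.1, h₁.2] at h₂
      exact le_antisymm h₂.1 h₂.2
  have emb_mem : MapsTo emb (sphere 0 1) (cell x ∩ {y | (free y).card < j}) := fun v hv => by
    obtain ⟨hv₁, k, hk⟩ := mem_sphere_pi_iff.1 hv
    have hc : emb v ∈ cell x := fun i => by
      by_cases hi : i ∈ free x
      · have h₁ := abs_le.1 (hv₁ (e ⟨i, hi⟩))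
        simp only [emb, dif_pos hi, ceil_eq_of_mem_free hi]
        push_cast
        constructor <;> linarith
      · have h₁ := eq_of_notMem_free hi
        simp only [emb, dif_neg hi, h₁.1, h₁.2]
        exact ⟨le_rfl, le_rfl⟩
    refine ⟨hc, ?_⟩
    rw [mem_ofPred_eq, ← hx]
    refine Finset.card_lt_card (Finset.ssubset_iff_subset_ne.2 ⟨free_subset hc, fun heq => ?_⟩)
    have hmem : ((e.symm k : free x) : ι) ∈ free (emb v) := by
      rw [heq]
      exact (e.symm k).2
    have hval : emb v (e.symm k) = ⌊x (e.symm k)⌋ + (v k + 1) / 2 := by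
      simp only [emb, dif_pos (e.symm k).2, Subtype.coe_eta, Equiv.apply_symm_apply]
    rcases (abs_eq zero_le_one).1 hk with h | h
    · refine notMem_free_of_eq (m := ⌊x (e.symm k)⌋ + 1) ?_ hmem
      rw [hval, h]
      push_cast
      ring
    · refine notMem_free_of_eq (m := ⌊x (e.symm k)⌋) ?_ hmem
      rw [hval, h]
      ring
  obtain ⟨Φ, hΦ, hΦ'⟩ := hX (g ∘ emb) (hg.comp emb_cont.continuousOn emb_mem)
  have proj_mem : ∀ y ∈ cell x, ∀ k, |proj y k| ≤ 1 := fun y hy k => by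
    have h₁ := hy (e.symm k)
    rw [ceil_eq_of_mem_free (e.symm k).2] at h₁
    push_cast at h₁
    simp only [proj, abs_le]
    constructor <;> linarith
  refine ⟨Φ ∘ proj, hΦ.comp proj_cont.continuousOn fun y hy =>
    mem_closedBall_pi_iff.2 (proj_mem y hy), fun y ⟨hy, hlt⟩ => ?_⟩
  have : proj y ∈ sphere (0 : Fin j → ℝ) 1 := by
    refine mem_sphere_pi_iff.2 ⟨proj_mem y hy, ?_⟩
    obtain ⟨i, hi, hiy⟩ : ∃ i ∈ free x, i ∉ free y := by
      by_contra! h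
      have := Finset.card_le_card h
      rw [hx] at this
      exact absurd hlt (not_lt.2 this)
    refine ⟨e ⟨i, hi⟩, ?_⟩
    have h₁ := hy i
    rw [ceil_eq_of_mem_free hi, ← (eq_of_notMem_free hiy).1] at h₁
    have h₂ : ⌊x i⌋ ≤ ⌊y i⌋ := Int.cast_le.1 h₁.1
    have h₃ : ⌊y i⌋ ≤ ⌊x i⌋ + 1 := Int.cast_le.1 h₁.2
    simp only [proj, Equiv.symm_apply_apply]
    rw [← (eq_of_notMem_free hiy).1]
    rcases (by omega : ⌊y i⌋ = ⌊x i⌋ ∨ ⌊y i⌋ = ⌊x i⌋ + 1) with h | h <;> rw [h] <;> push_cast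
    · norm_num
    · ring_nf
      norm_num
  rw [Function.comp_apply, hΦ' this, Function.comp_apply, emb_proj y hy]

/-- Extend a map from a subcomplex containing the `(j-1)`-skeleton over all `j`-cells. -/
theorem exists_extension_step {j : ℕ} (hX : ExtendsOver j X) {S : Set (ι → ℝ)}
    (hS : ∀ x ∈ S, cell x ⊆ S) (hj : {x | (free x).card < j} ⊆ S) {g : (ι → ℝ) → X}
    (hg : ContinuousOn g S) :
    ∃ g' : (ι → ℝ) → X, ContinuousOn g' (S ∪ {x | (free x).card < j + 1}) ∧ EqOn g' g S := by
  classical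
  have key : ∀ x : ι → ℝ, ∃ h : (ι → ℝ) → X, (free x).card = j → ContinuousOn h (cell x) ∧
      EqOn h g (cell x ∩ {y | (free y).card < j}) := fun x => by
    by_cases hx : (free x).card = j
    · obtain ⟨h, hh⟩ := exists_extension_cell hX hx (hg.mono (inter_subset_right.trans hj))
      exact ⟨h, fun _ => hh⟩
    · exact ⟨g, fun h => absurd h hx⟩
  choose h hh using key
  set g' : (ι → ℝ) → X := fun x => if x ∈ S then g x else h (center x) x with hg'
  have hgS : EqOn g' g S := fun x hx => if_pos hx
  refine ⟨g', ?_, hgS⟩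
  set S' := S ∪ {x | (free x).card < j + 1} with hS'
  have hS'cell : ∀ x ∈ S', cell x ⊆ S' := by
    rintro x (hx | hx) y hy
    · exact Or.inl (hS x hx hy)
    · exact Or.inr ((Finset.card_le_card (free_subset hy)).trans_lt hx)
  have hcell : ∀ z ∈ S', ContinuousOn g' (cell z) := by
    intro z hz
    by_cases hzS : z ∈ S
    · exact (hg.mono (hS z hzS)).congr (hgS.mono (hS z hzS))
    have hzj : (free z).card = j := by
      have h₁ : (free z).card < j + 1 := hz.resolve_left hzS
      have h₂ : ¬(free z).card < j := fun h' => hzS (hj h')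
      omega
    have hcj : (free (center z)).card = j := by
      rw [← hzj]
      exact le_antisymm (Finset.card_le_card (free_subset (center_mem_cell z)))
        (Finset.card_le_card (free_subset_free_center z))
    obtain ⟨h₁, h₂⟩ := hh (center z) hcj
    rw [cell_center] at h₁ h₂
    refine h₁.congr fun y hy => ?_
    by_cases hyj : (free y).card < j
    · rw [h₂ ⟨hy, hyj⟩]
      exact hgS (hj hyj)
    · have hsub : free z ⊆ free y :=
        (Finset.eq_of_subset_of_card_le (free_subset hy) (by omega)).ge
      have hyS : y ∉ S := fun h' => hzS (hS y h' (cell_eq hy hsub ▸ mem_cell_self z))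
      simp only [hg', if_neg hyS, center_eq hy hsub]
  have hfin : LocallyFinite fun c : {c : ι → ℤ // (fun i => (c i : ℝ) / 2) ∈ S'} =>
      cell (fun i => (c.1 i : ℝ) / 2) :=
    locallyFinite_cell.comp_injective Subtype.val_injective
  refine (hfin.continuousOn_iUnion (fun c => isClosed_cell _) fun c => hcell _ c.2).mono ?_
  intro x hx
  refine mem_iUnion.2 ⟨⟨fun i => ⌊x i⌋ + ⌈x i⌉, hS'cell x hx (center_mem_cell x)⟩, ?_⟩
  exact (cell_center x).symm ▸ mem_cell_self x

/-- A map on a subcomplex of the grid extends over the `a`-skeleton. -/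
theorem exists_extension_skeleton {a : ℕ} (hX : ∀ j ≤ a, ExtendsOver j X) {S : Set (ι → ℝ)}
    (hS : ∀ x ∈ S, cell x ⊆ S) {g : (ι → ℝ) → X} (hg : ContinuousOn g S) :
    ∃ g' : (ι → ℝ) → X, ContinuousOn g' (S ∪ {x | (free x).card ≤ a}) ∧ EqOn g' g S := by
  suffices H : ∀ m ≤ a + 1, ∃ g' : (ι → ℝ) → X,
      ContinuousOn g' (S ∪ {x | (free x).card < m}) ∧ EqOn g' g S by
    simpa only [Nat.lt_succ_iff] using H (a + 1) le_rfl
  intro m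
  induction m with
  | zero => exact fun _ => ⟨g, by simpa using hg, fun _ _ => rfl⟩
  | succ m ih =>
    intro hm
    obtain ⟨g₁, hg₁, hg₁'⟩ := ih (by omega)
    obtain ⟨g₂, hg₂, hg₂'⟩ := exists_extension_step (hX m (by omega))
      (S := S ∪ {x | (free x).card < m}) (by
        rintro x (hx | hx) y hy
        · exact Or.inl (hS x hx hy)
        · exact Or.inr ((Finset.card_le_card (free_subset hy)).trans_lt hx))
      subset_union_right hg₁
    refine ⟨g₂, hg₂.mono ?_, fun x hx => (hg₂' (Or.inl hx)).trans (hg₁' hx)⟩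
    exact union_subset (fun x hx => Or.inl (Or.inl hx)) subset_union_right

end CubicalGrid

section Extension

variable {X : Type*} [TopologicalSpace X]

section Normed

variable {E : Type*} [NormedAddCommGroup E]

theorem mem_sphere_prod_iff {w : ℝ × E} :
    w ∈ sphere (0 : ℝ × E) 1 ↔ (|w.1| ≤ 1 ∧ ‖w.2‖ ≤ 1) ∧ (w.1 = 1 ∨ w.1 = -1 ∨ ‖w.2‖ = 1) := by
  rw [mem_sphere_zero_iff_norm, Prod.norm_def, Real.norm_eq_abs]
  constructor
  · intro h
    refine ⟨⟨h ▸ le_max_left _ _, h ▸ le_max_right _ _⟩, ?_⟩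
    rcases max_choice |w.1| ‖w.2‖ with h' | h'
    · rw [← or_assoc, ← abs_eq zero_le_one]
      exact Or.inl (h' ▸ h)
    · exact Or.inr (Or.inr (h' ▸ h))
  · rintro ⟨⟨h₁, h₂⟩, h₃⟩
    rw [← or_assoc, ← abs_eq zero_le_one] at h₃
    refine le_antisymm (max_le h₁ h₂) ?_
    rcases h₃ with h | h
    exacts [h ▸ le_max_left _ _, h ▸ le_max_right _ _]

theorem mem_closedBall_prod_iff {w : ℝ × E} :
    w ∈ closedBall (0 : ℝ × E) 1 ↔ |w.1| ≤ 1 ∧ ‖w.2‖ ≤ 1 := by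
  rw [mem_closedBall_zero_iff, Prod.norm_def, Real.norm_eq_abs, max_le_iff]

variable [NormedSpace ℝ E]

/-- A map on the unit sphere extends over the ball if it is homotopic to one that does. -/
theorem exists_extension_of_homotopy {H : E × ℝ → X}
    (hH : ContinuousOn H (sphere 0 1 ×ˢ Icc 0 1)) {Φ' : E → X}
    (hΦ' : ContinuousOn Φ' (closedBall 0 1)) (h : ∀ v ∈ sphere (0 : E) 1, Φ' v = H (v, 1)) :
    ∃ Φ : E → X, ContinuousOn Φ (closedBall 0 1) ∧ ∀ v ∈ sphere (0 : E) 1, Φ v = H (v, 0) := by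
  classical
  have hinner : ∀ v : E, ‖v‖ ≤ 1 / 2 → (2 : ℝ) • v ∈ closedBall (0 : E) 1 := fun v hv => by
    rw [mem_closedBall_zero_iff, norm_smul, Real.norm_ofNat]
    linarith
  have hunit : ∀ v : E, 1 / 2 ≤ ‖v‖ → ‖v‖⁻¹ • v ∈ sphere (0 : E) 1 := fun v hv => by
    rw [mem_sphere_zero_iff_norm, norm_smul, norm_inv, norm_norm]
    exact inv_mul_cancel₀ (by linarith)
  refine ⟨fun v => if ‖v‖ ≤ 1 / 2 then Φ' ((2 : ℝ) • v) else H (‖v‖⁻¹ • v, 2 - 2 * ‖v‖), ?_, ?_⟩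
  · refine ContinuousOn.of_closed_cover (C := {v | ‖v‖ ≤ 1 / 2}) (D := {v | 1 / 2 ≤ ‖v‖})
      (isClosed_le continuous_norm continuous_const) (isClosed_le continuous_const continuous_norm)
      (fun v _ => le_total ‖v‖ (1 / 2)) ?_ ?_
    · refine (hΦ'.comp (continuous_const_smul (2 : ℝ)).continuousOn
        fun v hv => hinner v hv.2).congr fun v hv => ?_
      exact if_pos hv.2
    · have hc : ContinuousOn (fun v : E => (‖v‖⁻¹ • v, 2 - 2 * ‖v‖))
          (closedBall 0 1 ∩ {v | 1 / 2 ≤ ‖v‖}) := by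
        refine ContinuousOn.prodMk (ContinuousOn.smul (continuous_norm.continuousOn.inv₀ ?_)
          continuousOn_id) (by fun_prop)
        intro v hv
        have : 1 / 2 ≤ ‖v‖ := hv.2
        linarith
      refine (hH.comp hc fun v hv => ?_).congr fun v hv => ?_
      · have h₁ : ‖v‖ ≤ 1 := mem_closedBall_zero_iff.1 hv.1
        have h₂ : 1 / 2 ≤ ‖v‖ := hv.2
        exact ⟨hunit v hv.2, by constructor <;> linarith⟩
      · have h₂ : 1 / 2 ≤ ‖v‖ := hv.2
        by_cases hv' : ‖v‖ ≤ 1 / 2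
        · have h₃ : ‖v‖ = 1 / 2 := le_antisymm hv' h₂
          have h₄ := h _ (hunit v h₂)
          simp only [Function.comp_apply, if_pos hv']
          rw [h₃] at h₄ ⊢
          norm_num at h₄ ⊢
          exact h₄
        · simp only [Function.comp_apply, if_neg hv']
  · intro v hv
    rw [mem_sphere_zero_iff_norm] at hv
    simp only [hv]
    norm_num

/-- The retraction of the cylinder `[-1, 1] × ball` onto its bottom and sides. -/
noncomputable def boxRetraction (w : ℝ × E) : ℝ × E :=
  (3 - (3 - w.1) / max ‖w.2‖ ((3 - w.1) / 4), (max ‖w.2‖ ((3 - w.1) / 4))⁻¹ • w.2)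

theorem boxRetraction_eq_self {w : ℝ × E} (hw : w ∈ sphere (0 : ℝ × E) 1)
    (h : w.1 = -1 ∨ ‖w.2‖ = 1) : boxRetraction w = w := by
  have h₁ := mem_sphere_prod_iff.1 hw
  have h₂ := abs_le.1 h₁.1.1
  have hm : max ‖w.2‖ ((3 - w.1) / 4) = 1 := by
    rcases h with h | h
    · rw [h, max_eq_right] <;> linarith [h₁.1.2]
    · rw [h, max_eq_left]; linarith
  simp [boxRetraction, hm]

theorem boxRetraction_mem {w : ℝ × E} (hw : w ∈ closedBall (0 : ℝ × E) 1) :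
    boxRetraction w ∈ sphere (0 : ℝ × E) 1 := by
  obtain ⟨h₁, h₂⟩ := mem_closedBall_prod_iff.1 hw
  rw [abs_le] at h₁
  set m := max ‖w.2‖ ((3 - w.1) / 4) with hm
  have hm₁ : ‖w.2‖ ≤ m := le_max_left _ _
  have hm₂ : (3 - w.1) / 4 ≤ m := le_max_right _ _
  have hm₀ : 0 < m := by linarith
  have hm₃ : m ≤ (3 - w.1) / 2 := max_le (by linarith) (by linarith)
  have hnorm : ‖m⁻¹ • w.2‖ = ‖w.2‖ / m := by
    rw [norm_smul, norm_inv, Real.norm_of_nonneg hm₀.le, div_eq_inv_mul]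
  have h₃ : (3 - w.1) / m ≤ 4 := (div_le_iff₀ hm₀).2 (by linarith)
  have h₄ : 2 ≤ (3 - w.1) / m := (le_div_iff₀ hm₀).2 (by linarith)
  refine mem_sphere_prod_iff.2 ⟨⟨?_, ?_⟩, Or.inr ?_⟩
  · simp only [boxRetraction, ← hm, abs_le]
    constructor <;> linarith
  · simp only [boxRetraction, ← hm, hnorm]
    exact (div_le_one hm₀).2 hm₁
  · simp only [boxRetraction, ← hm, hnorm]
    rcases max_choice ‖w.2‖ ((3 - w.1) / 4) with h | h
    · right
      rw [← hm] at h
      rw [← h, div_self hm₀.ne']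
    · left
      rw [← hm] at h
      have : (3 - w.1) / m = 4 := (div_eq_iff hm₀.ne').2 (by linarith)
      rw [this]
      norm_num

theorem continuousOn_boxRetraction :
    ContinuousOn (boxRetraction : ℝ × E → ℝ × E) (closedBall 0 1) := by
  have hne : ∀ w ∈ closedBall (0 : ℝ × E) 1, max ‖w.2‖ ((3 - w.1) / 4) ≠ 0 := fun w hw => by
    have h₁ := abs_le.1 (mem_closedBall_prod_iff.1 hw).1
    exact (lt_of_lt_of_le (by linarith) (le_max_right _ _)).ne'
  have hm : Continuous fun w : ℝ × E => max ‖w.2‖ ((3 - w.1) / 4) := by fun_prop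
  unfold boxRetraction
  exact (continuousOn_const.sub ((by fun_prop : Continuous fun w : ℝ × E =>
    3 - w.1).continuousOn.div hm.continuousOn hne)).prodMk
    ((hm.continuousOn.inv₀ hne).smul continuous_snd.continuousOn)

/-- A map on the boundary of the cylinder `[-1, 1] × ball` is homotopic to one that is constant
away from the top. -/
theorem exists_homotopy_const_off_top {φ : ℝ × E → X} (hφ : ContinuousOn φ (sphere 0 1)) :
    ∃ (H : (ℝ × E) × ℝ → X) (x₀ : X), ContinuousOn H (sphere 0 1 ×ˢ Icc 0 1) ∧
      (∀ w ∈ sphere (0 : ℝ × E) 1, H (w, 0) = φ w) ∧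
      ∀ w ∈ sphere (0 : ℝ × E) 1, w.1 = -1 ∨ ‖w.2‖ = 1 → H (w, 1) = x₀ := by
  classical
  set ψ : ℝ × E → X := φ ∘ boxRetraction with hψdef
  have hψ : ContinuousOn ψ (closedBall 0 1) :=
    hφ.comp continuousOn_boxRetraction fun w hw => boxRetraction_mem hw
  have hψφ : ∀ w ∈ sphere (0 : ℝ × E) 1, w.1 = -1 ∨ ‖w.2‖ = 1 → ψ w = φ w := fun w hw h => by
    rw [hψdef, Function.comp_apply, boxRetraction_eq_self hw h]
  let top : E × ℝ → X := fun a =>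
    if ‖a.1‖ ≤ (2 - a.2) / 2 then φ (1, (2 / (2 - a.2)) • a.1)
    else ψ (((2 - a.2) / ‖a.1‖ - 1) • ((1 : ℝ), ‖a.1‖⁻¹ • a.1))
  let H : (ℝ × E) × ℝ → X := fun a =>
    if a.1.1 = 1 then top (a.1.2, a.2) else ψ ((1 - a.2) • a.1)
  have hunit : ∀ x : E, x ≠ 0 → ‖‖x‖⁻¹ • x‖ = 1 := fun x hx => by
    rw [norm_smul, norm_inv, norm_norm, inv_mul_cancel₀ (norm_ne_zero_iff.2 hx)]
  have hedge : ∀ x : E, ‖x‖ = 1 → ((1 : ℝ), x) ∈ sphere (0 : ℝ × E) 1 := fun x hx =>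
    mem_sphere_prod_iff.2 ⟨⟨by simp, hx.le⟩, Or.inl rfl⟩
  have hsmul : ∀ (c : ℝ) (w : ℝ × E), |c| ≤ 1 → w ∈ closedBall (0 : ℝ × E) 1 →
      c • w ∈ closedBall (0 : ℝ × E) 1 := fun c w hc hw => by
    rw [mem_closedBall_zero_iff] at hw ⊢
    rw [norm_smul]
    exact mul_le_one₀ hc (norm_nonneg _) hw
  have hbox : ∀ w ∈ sphere (0 : ℝ × E) 1, w.1 = -1 ∨ ‖w.2‖ = 1 → ∀ τ ∈ Icc (0 : ℝ) 1,
      H (w, τ) = ψ ((1 - τ) • w) := by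
    rintro ⟨s, x⟩ hw h τ hτ
    by_cases hs : s = 1
    · subst hs
      have hx : ‖x‖ = 1 := h.resolve_left (by norm_num)
      simp only [H, if_true, top, hx]
      by_cases h0 : 1 ≤ (2 - τ) / 2
      · have : τ = 0 := le_antisymm (by linarith) hτ.1
        subst this
        simp [hψφ _ hw h]
      · rw [if_neg h0]
        congr 2
        · ring
        · simp
    · simp only [H, if_neg hs]
  have htop : ContinuousOn top (closedBall 0 1 ×ˢ Icc 0 1) := by
    refine ContinuousOn.of_closed_cover (C := {a | ‖a.1‖ ≤ (2 - a.2) / 2})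
      (D := {a | (2 - a.2) / 2 ≤ ‖a.1‖}) (isClosed_le (by fun_prop) (by fun_prop))
      (isClosed_le (by fun_prop) (by fun_prop)) (fun a _ => le_total ‖a.1‖ ((2 - a.2) / 2)) ?_ ?_
    · have hpos : ∀ a ∈ (closedBall (0 : E) 1 ×ˢ Icc (0 : ℝ) 1) ∩
          {a | ‖a.1‖ ≤ (2 - a.2) / 2}, 0 < 2 - a.2 := fun a ha => by
        linarith [ha.1.2.2]
      refine ContinuousOn.congr (f := fun a : E × ℝ => φ (1, (2 / (2 - a.2)) • a.1)) ?_
        fun a ha => if_pos ha.2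
      refine hφ.comp (continuousOn_const.prodMk (ContinuousOn.smul (ContinuousOn.div
        continuousOn_const (by fun_prop) fun a ha => (hpos a ha).ne')
        continuous_fst.continuousOn)) fun a ha => ?_
      refine mem_sphere_prod_iff.2 ⟨⟨by simp, ?_⟩, Or.inl rfl⟩
      have h₁ : ‖a.1‖ ≤ (2 - a.2) / 2 := ha.2
      have h₂ := hpos a ha
      rw [norm_smul, Real.norm_of_nonneg (by positivity), div_mul_eq_mul_div, div_le_one h₂]
      linarith
    · have hpos : ∀ a ∈ (closedBall (0 : E) 1 ×ˢ Icc (0 : ℝ) 1) ∩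
          {a | (2 - a.2) / 2 ≤ ‖a.1‖}, 0 < ‖a.1‖ := fun a ha => by
        have h₁ : (2 - a.2) / 2 ≤ ‖a.1‖ := ha.2
        linarith [ha.1.2.2]
      have hn : ContinuousOn (fun a : E × ℝ => ‖a.1‖) ((closedBall (0 : E) 1 ×ˢ Icc (0 : ℝ) 1) ∩
          {a | (2 - a.2) / 2 ≤ ‖a.1‖}) := by fun_prop
      refine ContinuousOn.congr (f := fun a : E × ℝ =>
        ψ (((2 - a.2) / ‖a.1‖ - 1) • ((1 : ℝ), ‖a.1‖⁻¹ • a.1))) ?_ fun a ha => ?_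
      · refine hψ.comp (ContinuousOn.smul ((ContinuousOn.div (by fun_prop) hn
          fun a ha => (hpos a ha).ne').sub continuousOn_const) (continuousOn_const.prodMk
          ((hn.inv₀ fun a ha => (hpos a ha).ne').smul continuous_fst.continuousOn)))
          fun a ha => hsmul _ _ ?_ (sphere_subset_closedBall (hedge _ (hunit _ ?_)))
        · have h₁ : (2 - a.2) / 2 ≤ ‖a.1‖ := ha.2
          have h₂ := hpos a ha
          have h₃ : ‖a.1‖ ≤ 1 := mem_closedBall_zero_iff.1 ha.1.1
          have h₄ : (2 - a.2) / ‖a.1‖ ≤ 2 := (div_le_iff₀ h₂).2 (by linarith)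
          have h₅ : 1 ≤ (2 - a.2) / ‖a.1‖ := (le_div_iff₀ h₂).2 (by linarith [ha.1.2.2])
          rw [abs_le]
          constructor <;> linarith
        · exact norm_pos_iff.1 (hpos a ha)
      · have h₁ : (2 - a.2) / 2 ≤ ‖a.1‖ := ha.2
        have h₂ := hpos a ha
        by_cases hle : ‖a.1‖ ≤ (2 - a.2) / 2
        · have h₃ : 2 - a.2 = 2 * ‖a.1‖ := by linarith
          have h₄ := hedge _ (hunit _ (norm_pos_iff.1 h₂))
          have h₅ : 2 / (2 * ‖a.1‖) = ‖a.1‖⁻¹ := by field_simp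
          have h₆ : 2 * ‖a.1‖ / ‖a.1‖ - 1 = 1 := by field_simp; norm_num
          simp only [top, if_pos hle]
          rw [h₃, h₅, h₆, one_smul, hψφ _ h₄ (Or.inr (hunit _ (norm_pos_iff.1 h₂)))]
        · simp only [top, if_neg hle]
  refine ⟨H, ψ 0, ?_, fun w hw => ?_, fun w hw h => ?_⟩
  · refine ContinuousOn.of_closed_cover (C := {a | a.1.1 = 1})
      (D := {a | a.1.1 = -1} ∪ {a | ‖a.1.2‖ = 1}) (isClosed_eq (by fun_prop) (by fun_prop))
      ((isClosed_eq (by fun_prop) (by fun_prop)).union (isClosed_eq (by fun_prop) (by fun_prop)))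
      (fun a ha => (mem_sphere_prod_iff.1 ha.1).2) ?_ ?_
    · refine (htop.comp (f := fun a : (ℝ × E) × ℝ => (a.1.2, a.2)) (by fun_prop)
        fun a ha => ⟨?_, ha.1.2⟩).congr fun a ha => if_pos ha.2
      exact mem_closedBall_zero_iff.2 (mem_sphere_prod_iff.1 ha.1.1).1.2
    · refine (hψ.comp (f := fun a : (ℝ × E) × ℝ => (1 - a.2) • a.1) (by fun_prop)
        fun a ha => hsmul _ _ ?_ (sphere_subset_closedBall ha.1.1)).congr
        fun a ha => hbox a.1 ha.1.1 ha.2 a.2 ha.1.2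
      have h₁ := ha.1.2
      rw [abs_le]
      constructor <;> linarith [h₁.1, h₁.2]
  · obtain ⟨⟨h₁, h₂⟩, h₃⟩ := mem_sphere_prod_iff.1 hw
    by_cases h : w.1 = 1
    · have : ‖w.2‖ ≤ (2 - 0) / 2 := by linarith
      simp only [H, if_pos h, top, if_pos this]
      congr 1
      ext
      · exact h.symm
      · simp
    · rw [hbox w hw (h₃.resolve_left h) 0 (by simp), sub_zero, one_smul,
        hψφ w hw (h₃.resolve_left h)]
  · rw [hbox w hw h 1 (by simp), sub_self, zero_smul]

end Normed
/-- The extension property over the `(k+1)`-cube, in product coordinates. -/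
theorem extendsOver_succ_iff {k : ℕ} : ExtendsOver (k + 1) X ↔
    ∀ φ : ℝ × (Fin k → ℝ) → X, ContinuousOn φ (sphere 0 1) →
      ∃ Φ : ℝ × (Fin k → ℝ) → X, ContinuousOn Φ (closedBall 0 1) ∧ EqOn Φ φ (sphere 0 1) := by
  let c : ℝ × (Fin k → ℝ) → Fin (k + 1) → ℝ := fun w => Fin.cons w.1 w.2
  let d : (Fin (k + 1) → ℝ) → ℝ × (Fin k → ℝ) := fun v => (v 0, fun i => v i.succ)
  have hc : Continuous c := continuous_pi fun i => by
    refine Fin.cases ?_ (fun i => ?_) i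
    · simpa only [c, Fin.cons_zero] using continuous_fst
    · simp only [c, Fin.cons_succ]
      fun_prop
  have hd : Continuous d := by fun_prop
  have hcd : ∀ v, c (d v) = v := fun v => Fin.cons_self_tail v
  have hdc : ∀ w, d (c w) = w := fun w => rfl
  have hnorm : ∀ v, ‖d v‖ = ‖v‖ := fun v => by
    refine le_antisymm (max_le (norm_le_pi_norm v 0) ?_) ?_
    · exact (pi_norm_le_iff_of_nonneg (norm_nonneg _)).2 fun i => norm_le_pi_norm v i.succ
    · refine (pi_norm_le_iff_of_nonneg (norm_nonneg _)).2 fun i => ?_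
      refine Fin.cases (norm_fst_le (d v)) (fun i => ?_) i
      exact (norm_le_pi_norm (d v).2 i).trans (norm_snd_le (d v))
  have hnorm' : ∀ w, ‖c w‖ = ‖w‖ := fun w => by rw [← hnorm, hdc]
  constructor
  · intro h φ hφ
    obtain ⟨Φ, h₁, h₂⟩ := h (φ ∘ d) (hφ.comp hd.continuousOn fun v hv => by
      simpa [mem_sphere_zero_iff_norm, hnorm] using hv)
    refine ⟨Φ ∘ c, h₁.comp hc.continuousOn fun w hw => ?_, fun w hw => ?_⟩
    · simpa [mem_closedBall_zero_iff, hnorm'] using hw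
    · have : c w ∈ sphere (0 : Fin (k + 1) → ℝ) 1 := by
        rw [mem_sphere_zero_iff_norm] at hw ⊢
        rw [hnorm', hw]
      rw [Function.comp_apply, h₂ this, Function.comp_apply, hdc]
  · intro h φ hφ
    obtain ⟨Φ, h₁, h₂⟩ := h (φ ∘ c) (hφ.comp hc.continuousOn fun v hv => by
      rw [mem_sphere_zero_iff_norm] at hv ⊢
      rw [hnorm', hv])
    refine ⟨Φ ∘ d, h₁.comp hd.continuousOn fun w hw => ?_, fun w hw => ?_⟩
    · simpa [mem_closedBall_zero_iff, hnorm] using hw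
    · have : d w ∈ sphere (0 : ℝ × (Fin k → ℝ)) 1 := by
        rw [mem_sphere_zero_iff_norm] at hw ⊢
        rw [hnorm, hw]
      rw [Function.comp_apply, h₂ this, Function.comp_apply, hcd]

/-- The affine map from `[-1, 1]` to the unit interval, clamped to a map on the real line. -/
noncomputable def toUnit (s : ℝ) : I := projIcc 0 1 zero_le_one ((s + 1) / 2)

theorem continuous_toUnit : Continuous toUnit := continuous_projIcc.comp (by fun_prop)

theorem toUnit_one : toUnit 1 = 1 := projIcc_of_right_le _ (by norm_num)

theorem toUnit_neg_one : toUnit (-1) = 0 := projIcc_of_le_left _ (by norm_num)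

theorem toUnit_affine (t : I) : toUnit (2 * t - 1) = t := by
  simp [toUnit]

theorem two_mul_toUnit_sub_one {s : ℝ} (hs : |s| ≤ 1) : 2 * (toUnit s : ℝ) - 1 = s := by
  rw [abs_le] at hs
  rw [toUnit, projIcc_of_mem zero_le_one (by constructor <;> linarith)]
  simp only
  ring

theorem toUnit_mem_boundary {k : ℕ} {x : Fin k → ℝ} (hx : ‖x‖ = 1) :
    (fun i => toUnit (x i)) ∈ Cube.boundary (Fin k) := by
  obtain ⟨-, i, hi⟩ := mem_sphere_pi_iff.1 (mem_sphere_zero_iff_norm.2 hx)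
  refine ⟨i, ?_⟩
  rcases (abs_eq zero_le_one).1 hi with h | h
  · exact Or.inr (by simp only [h, toUnit_one])
  · exact Or.inl (by simp only [h, toUnit_neg_one])

theorem norm_affine_le_one {k : ℕ} (y : I^ (Fin k)) : ‖fun i => 2 * (y i : ℝ) - 1‖ ≤ 1 := by
  rw [← mem_closedBall_zero_iff, mem_closedBall_pi_iff]
  intro i
  rw [abs_le]
  constructor <;> linarith [(y i).2.1, (y i).2.2]

theorem norm_affine_eq_one {k : ℕ} {y : I^ (Fin k)} (hy : y ∈ Cube.boundary (Fin k)) :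
    ‖fun i => 2 * (y i : ℝ) - 1‖ = 1 := by
  rw [← mem_sphere_zero_iff_norm, mem_sphere_pi_iff]
  refine ⟨mem_closedBall_pi_iff.1 (mem_closedBall_zero_iff.2 (norm_affine_le_one y)), ?_⟩
  obtain ⟨i, hi | hi⟩ := hy <;> refine ⟨i, ?_⟩ <;> rw [hi] <;> norm_num

theorem subsingleton_homotopyGroup_of_extendsOver {k : ℕ} (h : ExtendsOver (k + 1) X) (x : X) :
    Subsingleton (HomotopyGroup (Fin k) X x) := by
  classical
  refine ⟨fun a b => Quotient.inductionOn₂ a b fun f g => Quotient.sound ?_⟩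
  have hU : Continuous fun w : ℝ × (Fin k → ℝ) => (fun i => toUnit (w.2 i) : I^ (Fin k)) := by
    have := continuous_toUnit
    fun_prop
  obtain ⟨Φ, h₁, h₂⟩ := extendsOver_succ_iff.1 h
    (fun w => if w.1 ≤ 0 then f fun i => toUnit (w.2 i) else g fun i => toUnit (w.2 i)) (by
      refine ContinuousOn.of_closed_cover (C := {w | w.1 ≤ 0}) (D := {w | 0 ≤ w.1})
        (isClosed_le (by fun_prop) (by fun_prop)) (isClosed_le (by fun_prop) (by fun_prop))
        (fun w _ => le_total w.1 0) ?_ ?_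
      · exact (f.1.continuous.comp hU).continuousOn.congr fun w hw => if_pos hw.2
      · refine (g.1.continuous.comp hU).continuousOn.congr fun w hw => ?_
        by_cases hle : w.1 ≤ 0
        · have h0 : w.1 = 0 := le_antisymm hle hw.2
          have hb : ‖w.2‖ = 1 := by
            have := (mem_sphere_prod_iff.1 hw.1).2
            rw [h0] at this
            norm_num at this
            exact this
          simp only [if_pos hle]
          exact (f.2 _ (toUnit_mem_boundary hb)).trans (g.2 _ (toUnit_mem_boundary hb)).symm
        · exact if_neg hle)
  have hball : ∀ a : I × (I^ (Fin k)), ((2 * (a.1 : ℝ) - 1, fun i => 2 * (a.2 i : ℝ) - 1) :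
      ℝ × (Fin k → ℝ)) ∈ closedBall (0 : ℝ × (Fin k → ℝ)) 1 := fun a => by
    refine mem_closedBall_prod_iff.2 ⟨?_, norm_affine_le_one _⟩
    rw [abs_le]
    constructor <;> linarith [a.1.2.1, a.1.2.2]
  refine ⟨⟨⟨⟨fun a => Φ (2 * (a.1 : ℝ) - 1, fun i => 2 * (a.2 i : ℝ) - 1), ?_⟩, ?_, ?_⟩, ?_⟩⟩
  · exact h₁.comp_continuous (by fun_prop) hball
  · intro y
    refine (h₂ (mem_sphere_prod_iff.2 ⟨mem_closedBall_prod_iff.1 (hball (0, y)),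
      Or.inr (Or.inl ?_)⟩)).trans ?_
    · simp
    · simp only [toUnit_affine]
      exact if_pos (by simp)
  · intro y
    refine (h₂ (mem_sphere_prod_iff.2 ⟨mem_closedBall_prod_iff.1 (hball (1, y)),
      Or.inl ?_⟩)).trans ?_
    · norm_num
    · simp only [toUnit_affine]
      exact if_neg (by norm_num)
  · intro t y hy
    refine (h₂ (mem_sphere_prod_iff.2 ⟨mem_closedBall_prod_iff.1 (hball (t, y)),
      Or.inr (Or.inr (norm_affine_eq_one hy))⟩)).trans ?_
    simp only [toUnit_affine]
    have hfg : f y = g y := (f.2 y hy).trans (g.2 y hy).symm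
    split_ifs
    exacts [rfl, hfg.symm]

theorem extendsOver_succ_of_subsingleton {k : ℕ}
    (h : ∀ x : X, Subsingleton (HomotopyGroup (Fin k) X x)) : ExtendsOver (k + 1) X := by
  refine extendsOver_succ_iff.2 fun φ hφ => ?_
  obtain ⟨H, x₀, hH, hH₀, hH₁⟩ := exists_homotopy_const_off_top hφ
  have htop : ∀ x : Fin k → ℝ, ‖x‖ ≤ 1 →
      ((1 : ℝ), x) ∈ sphere (0 : ℝ × (Fin k → ℝ)) 1 := fun x hx =>
    mem_sphere_prod_iff.2 ⟨⟨by simp, hx⟩, Or.inl rfl⟩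
  let f : GenLoop (Fin k) X x₀ := ⟨⟨fun y => H ((1, fun i => 2 * (y i : ℝ) - 1), 1),
    hH.comp_continuous (by fun_prop) fun y => ⟨htop _ (norm_affine_le_one y), by simp⟩⟩,
    fun y hy => hH₁ _ (htop _ (norm_affine_le_one y)) (Or.inr (norm_affine_eq_one hy))⟩
  obtain ⟨G⟩ : GenLoop.Homotopic GenLoop.const f :=
    Quotient.exact ((h x₀).elim (Quotient.mk _ GenLoop.const) (Quotient.mk _ f))
  have hU : Continuous fun w : ℝ × (Fin k → ℝ) =>
      ((toUnit w.1, fun i => toUnit (w.2 i)) : I × (I^ (Fin k))) := by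
    have := continuous_toUnit
    fun_prop
  obtain ⟨Φ, hΦ, hΦ'⟩ := exists_extension_of_homotopy hH
    (Φ' := fun w => G (toUnit w.1, fun i => toUnit (w.2 i)))
    (G.continuous.comp hU).continuousOn (by
      intro w hw
      obtain ⟨⟨h₁, h₂⟩, h₃⟩ := mem_sphere_prod_iff.1 hw
      rcases h₃ with h₃ | h₃ | h₃
      · simp only [h₃, toUnit_one]
        refine (G.apply_one _).trans ?_
        have : (fun i => 2 * (toUnit (w.2 i) : ℝ) - 1) = w.2 := funext fun i =>
          two_mul_toUnit_sub_one ((norm_le_pi_norm w.2 i).trans h₂)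
        have hw' : w = (1, w.2) := Prod.ext h₃ rfl
        rw [hw']
        simp only [f, ContinuousMap.coe_mk, this]
      · rw [hH₁ w hw (Or.inl h₃)]
        simp only [h₃, toUnit_neg_one]
        exact G.apply_zero _
      · rw [hH₁ w hw (Or.inr h₃)]
        exact G.eq_fst _ (toUnit_mem_boundary h₃))
  exact ⟨Φ, hΦ, fun w hw => (hΦ' w hw).trans (hH₀ w hw)⟩

theorem extendsOver_zero [Nonempty X] : ExtendsOver 0 X := fun _ _ =>
  ⟨fun _ => Classical.arbitrary X, continuousOn_const, fun v hv => by
    rw [Subsingleton.elim v 0, mem_sphere_zero_iff_norm, norm_zero] at hv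
    exact absurd hv zero_ne_one⟩

theorem NConnected.extendsOver {n : ℕ} (h : NConnected n X) {j : ℕ} (hj : j ≤ n + 1) :
    ExtendsOver j X := by
  have := h.1
  rcases j with - | k
  · exact extendsOver_zero
  refine extendsOver_succ_of_subsingleton fun x => ?_
  rcases Nat.eq_zero_or_pos k with rfl | hk
  · have := (pathConnectedSpace_iff_zerothHomotopy.1 h.1).2
    exact HomotopyGroup.pi0EquivZerothHomotopy.subsingleton
  · exact h.2 k hk (by omega) x

theorem nConnected_of_extendsOver [Nonempty X] {n : ℕ} (h : ∀ k ≤ n, ExtendsOver (k + 1) X) :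
    NConnected n X := by
  refine ⟨?_, fun k _ hk x => subsingleton_homotopyGroup_of_extendsOver (h k hk) x⟩
  have := subsingleton_homotopyGroup_of_extendsOver (h 0 n.zero_le) (Classical.arbitrary X)
  exact pathConnectedSpace_iff_zerothHomotopy.2
    ⟨inferInstance, (HomotopyGroup.pi0EquivZerothHomotopy
      (x := Classical.arbitrary X)).symm.subsingleton⟩

end Extension

namespace CubicalGrid

/-- The distance of `u` from the nearest half-integer. -/
noncomputable def distHalf (u : ℝ) : ℝ := |Int.fract u - 1 / 2|

theorem continuous_distHalf : Continuous distHalf := by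
  refine ContinuousOn.comp_fract'' (f := fun t : ℝ => |t - 1 / 2|) (by fun_prop) ?_
  norm_num [abs_of_pos, abs_of_neg]

theorem le_distHalf_of_distHalf_add_half_lt {u : ℝ} (h : distHalf (u + 1 / 2) < 1 / 8) :
    3 / 8 ≤ distHalf u := by
  have h₁ := Int.floor_le u
  have h₂ := Int.lt_floor_add_one u
  have h₃ := Int.floor_le (u + 1 / 2)
  have h₄ := Int.lt_floor_add_one (u + 1 / 2)
  have h₅ : ⌊u⌋ ≤ ⌊u + 1 / 2⌋ := Int.floor_le_floor (by linarith)
  have h₆ : ⌊u + 1 / 2⌋ ≤ ⌊u⌋ + 1 := by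
    rw [← Int.floor_add_one]
    exact Int.floor_le_floor (by linarith)
  rw [distHalf, Int.fract, abs_lt] at h
  rw [distHalf, Int.fract, le_abs]
  rcases (by omega : ⌊u + 1 / 2⌋ = ⌊u⌋ ∨ ⌊u + 1 / 2⌋ = ⌊u⌋ + 1) with h₇ | h₇ <;>
    rw [h₇] at h <;> push_cast at h
  · right
    linarith
  · left
    linarith

/-- A continuous map of the line preserving the cells of the integer grid and collapsing the
`3 / 8`-neighbourhood of each integer to that integer. -/
noncomputable def collapse (u : ℝ) : ℝ :=
  u + (max 0 (min 1 (4 * Int.fract u - 3 / 2)) - Int.fract u)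

theorem continuous_collapse : Continuous collapse := by
  refine continuous_id.add (ContinuousOn.comp_fract''
    (f := fun t : ℝ => max 0 (min 1 (4 * t - 3 / 2)) - t) (by fun_prop) ?_)
  norm_num

theorem collapse_eq (u : ℝ) :
    collapse u = ⌊u⌋ + max 0 (min 1 (4 * Int.fract u - 3 / 2)) := by
  rw [collapse]
  linarith [Int.floor_add_fract u]

theorem collapse_mem (u : ℝ) : (⌊u⌋ : ℝ) ≤ collapse u ∧ collapse u ≤ ⌈u⌉ := by
  rw [collapse_eq]
  refine ⟨le_add_of_nonneg_right (le_max_left _ _), ?_⟩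
  rcases eq_or_ne (Int.fract u) 0 with h | h
  · rw [h]
    norm_num
    exact Int.floor_le_ceil u
  · have h₁ : ⌈u⌉ = ⌊u⌋ + 1 := Int.ceil_eq_floor_add_one_iff_notMem u |>.2 fun h' =>
      h (Int.fract_eq_zero_iff.2 h')
    rw [h₁]
    push_cast
    gcongr
    exact max_le zero_le_one (min_le_left _ _)

theorem exists_collapse_eq_intCast {u : ℝ} (h : 1 / 8 ≤ distHalf u) :
    ∃ m : ℤ, collapse u = m := by
  rw [distHalf, le_abs] at h
  rw [collapse_eq]
  rcases h with h | h
  · refine ⟨⌊u⌋ + 1, ?_⟩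
    rw [min_eq_left (by linarith), max_eq_right zero_le_one]
    push_cast
    rfl
  · refine ⟨⌊u⌋, ?_⟩
    rw [max_eq_left ((min_le_right _ _).trans (by linarith)), add_zero]

theorem isClosed_card_le {ι α : Type*} [Fintype ι] [TopologicalSpace α] {C : ι → Set α}
    [∀ x, DecidablePred fun i => x ∈ C i] (hC : ∀ i, IsClosed (C i)) (m : ℕ) :
    IsClosed {x | m ≤ (Finset.univ.filter fun i => x ∈ C i).card} := by
  have : {x | m ≤ (Finset.univ.filter fun i => x ∈ C i).card} =
      ⋃ s : {s : Finset ι // m ≤ s.card}, ⋂ i ∈ s.1, C i := by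
    ext x
    simp only [mem_iUnion, mem_iInter, mem_ofPred_eq]
    constructor
    · exact fun h => ⟨⟨_, h⟩, fun i hi => (Finset.mem_filter.1 hi).2⟩
    · rintro ⟨s, hs⟩
      exact s.2.trans (Finset.card_le_card fun i hi =>
        Finset.mem_filter.2 ⟨Finset.mem_univ i, hs i hi⟩)
  rw [this]
  exact isClosed_iUnion_of_finite fun s => isClosed_biInter fun i _ => hC i

/-- A map defined on `U` is extended over a neighbourhood of the `a`-skeleton of the grid
translated by `-h`, at the cost of precomposing it with a deformation preserving cells. The
amount `l` of deformation may vary: the extension is only available where `l = 1`, and the map is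
unchanged where `l = 0`. -/
theorem exists_extension_near_skeleton {ι X : Type*} [Fintype ι] [TopologicalSpace X] {a : ℕ}
    (hX : ∀ j ≤ a, ExtendsOver j X) {U : Set (ι → ℝ)} {f : (ι → ℝ) → X} (hf : ContinuousOn f U)
    (h : ι → ℝ) {l : (ι → ℝ) → ℝ} (hl : Continuous l) (hl' : ∀ x, l x ∈ Icc (0 : ℝ) 1) :
    ∃ F : (ι → ℝ) → X,
      ContinuousOn F ({x | l x = 1 ∧
        (Finset.univ.filter fun i => distHalf (x i + h i) < 1 / 8).card ≤ a} ∪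
        {x | closedBall x 1 ⊆ U}) ∧
      ∀ x, l x = 0 → closedBall x 1 ⊆ U → F x = f x := by
  set S : Set (ι → ℝ) := {y | ∀ z ∈ cell y, z - h ∈ U} with hSdef
  have hS : ∀ x ∈ S, cell x ⊆ S := fun x hx y hy z hz => hx z (cell_subset hy hz)
  obtain ⟨g, hg, hgf⟩ := exists_extension_skeleton hX hS (g := fun y => f (y - h))
    (hf.comp (by fun_prop) fun y hy => hy y (mem_cell_self y))
  have hUS : ∀ x, closedBall x 1 ⊆ U → x + h ∈ S := fun x hx z hz => hx <| by
    rw [mem_closedBall, dist_pi_le_iff zero_le_one]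
    intro i
    have := abs_sub_le_of_mem_cell hz i
    rw [Real.dist_eq, Pi.sub_apply]
    rwa [Pi.add_apply, add_comm, ← sub_sub] at this
  let D : (ι → ℝ) → ι → ℝ := fun x i => x i + h i + l x * (collapse (x i + h i) - (x i + h i))
  have hD : Continuous D := by
    have := continuous_collapse
    fun_prop
  have hDcell : ∀ x, D x ∈ cell (x + h) := fun x i => by
    have h₁ := collapse_mem (x i + h i)
    have h₂ := Int.floor_le (x i + h i)
    have h₃ := Int.le_ceil (x i + h i)
    have h₄ := hl' x
    simp only [D, Pi.add_apply]
    constructor <;> nlinarith [h₄.1, h₄.2]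
  refine ⟨g ∘ D, hg.comp hD.continuousOn ?_, fun x hx hxU => ?_⟩
  · rintro x (⟨hx₁, hx₂⟩ | hx)
    · refine Or.inr ((Finset.card_le_card fun i hi => ?_).trans hx₂)
      rw [Finset.mem_filter]
      refine ⟨Finset.mem_univ i, ?_⟩
      by_contra! hlt
      obtain ⟨m, hm⟩ := exists_collapse_eq_intCast hlt
      refine notMem_free_of_eq (m := m) ?_ hi
      simp only [D, hx₁, hm]
      ring
    · exact Or.inl (hS _ (hUS x hx) (hDcell x))
  · have hDx : D x = x + h := by
      ext i
      simp [D, hx]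
    simp only [Function.comp_apply, hDx, hgf (hUS x hxU), add_sub_cancel_right]

end CubicalGrid

section Radial

variable {E : Type*} [NormedAddCommGroup E] [NormedSpace ℝ E]

theorem norm_unit_sub_unit_le {x y : E} (hx : x ≠ 0) (hy : y ≠ 0) :
    ‖‖y‖⁻¹ • y - ‖x‖⁻¹ • x‖ ≤ 2 * ‖y - x‖ / ‖x‖ := by
  have hx' := norm_pos_iff.2 hx
  have hy' := norm_pos_iff.2 hy
  have h : ‖y‖⁻¹ • y - ‖x‖⁻¹ • x = (‖y‖⁻¹ - ‖x‖⁻¹) • y + ‖x‖⁻¹ • (y - x) := by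
    module
  have h₁ : ‖(‖y‖⁻¹ - ‖x‖⁻¹) • y‖ ≤ ‖y - x‖ / ‖x‖ := by
    rw [norm_smul, Real.norm_eq_abs, ← abs_norm y, ← abs_mul, abs_norm,
      show (‖y‖⁻¹ - ‖x‖⁻¹) * ‖y‖ = (‖x‖ - ‖y‖) / ‖x‖ by field_simp, abs_div, abs_norm]
    gcongr
    rw [abs_sub_comm]
    exact abs_norm_sub_norm_le y x
  have h₂ : ‖‖x‖⁻¹ • (y - x)‖ = ‖y - x‖ / ‖x‖ := by
    rw [norm_smul, norm_inv, norm_norm, inv_mul_eq_div]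
  rw [h]
  calc _ ≤ _ := norm_add_le _ _
    _ ≤ ‖y - x‖ / ‖x‖ + ‖y - x‖ / ‖x‖ := by gcongr; exact h₂.le
    _ = _ := by ring

theorem continuousOn_unit : ContinuousOn (fun x : E => ‖x‖⁻¹ • x) {x | x ≠ 0} :=
  (continuous_norm.continuousOn.inv₀ fun _ hx => norm_ne_zero_iff.2 hx).smul continuousOn_id

theorem unit_mem_sphere {x : E} (hx : x ≠ 0) : ‖x‖⁻¹ • x ∈ sphere (0 : E) 1 := by
  rw [mem_sphere_zero_iff_norm, norm_smul, norm_inv, norm_norm,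
    inv_mul_cancel₀ (norm_ne_zero_iff.2 hx)]

/-- A continuous function on the sphere varies slowly at large radius. -/
theorem exists_radius [ProperSpace E] {T : E → ℝ} (hT : ContinuousOn T (sphere 0 1)) {ε : ℝ}
    (hε : 0 < ε) : ∃ M : ℝ, 0 < M ∧ ∀ x y : E, 6 * M ≤ ‖x‖ → y ∈ closedBall x 1 →
      y ≠ 0 ∧ |T (‖y‖⁻¹ • y) - T (‖x‖⁻¹ • x)| < ε := by
  obtain ⟨δ, hδ, H⟩ := Metric.uniformContinuousOn_iff.1
    ((isCompact_sphere (0 : E) 1).uniformContinuousOn_of_continuous hT) ε hε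
  refine ⟨max 1 (1 / δ), by positivity, fun x y hx hy => ?_⟩
  have h₁ : 1 ≤ max 1 (1 / δ) := le_max_left _ _
  have h₂ : 1 / δ ≤ max 1 (1 / δ) := le_max_right _ _
  rw [mem_closedBall, dist_eq_norm] at hy
  have h₃ : ‖x‖ ≤ ‖y‖ + ‖y - x‖ := by
    rw [norm_sub_rev]
    exact norm_le_norm_add_norm_sub' x y
  have hx0 : 0 < ‖x‖ := by linarith
  have hy0 : 0 < ‖y‖ := by linarith
  have hx' := norm_pos_iff.1 hx0
  have hy' := norm_pos_iff.1 hy0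
  refine ⟨hy', ?_⟩
  rw [← Real.dist_eq]
  refine H _ (unit_mem_sphere hy') _ (unit_mem_sphere hx') ?_
  rw [dist_eq_norm]
  refine (norm_unit_sub_unit_le hx' hy').trans_lt ?_
  rw [div_lt_iff₀ hx0]
  have h₄ : 1 ≤ δ * max 1 (1 / δ) := by
    calc 1 = δ * (1 / δ) := by field_simp
      _ ≤ _ := by gcongr
  nlinarith

end Radial

open CubicalGrid in
/-- If maps from spheres into `Y` and `Z` extend over cubes of dimension at most `a` and `b`, then
those into the join extend over cubes of dimension at most `a + b + 1`. -/
theorem Join.extendsOver {Y Z : Type*} [TopologicalSpace Y] [TopologicalSpace Z] {a b n : ℕ}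
    (hY : ∀ j ≤ a, ExtendsOver j Y) (hZ : ∀ j ≤ b, ExtendsOver j Z) (hn : n ≤ a + b + 1) :
    ExtendsOver n (Join Y Z) := by
  intro φ hφ
  let ψ : (Fin n → ℝ) → Join Y Z := fun x => φ (‖x‖⁻¹ • x)
  have hψ : ContinuousOn ψ {x | x ≠ 0} :=
    hφ.comp continuousOn_unit fun x hx => unit_mem_sphere hx
  obtain ⟨M, hM, hMT⟩ := exists_radius (T := fun x => (height (φ x) : ℝ))
    (continuous_subtype_val.comp_continuousOn (continuous_height.comp_continuousOn hφ))
    (ε := 1 / 3) (by norm_num)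
  let T : (Fin n → ℝ) → ℝ := fun x => height (ψ x)
  have hT : ContinuousOn T {x | x ≠ 0} :=
    continuous_subtype_val.comp_continuousOn (continuous_height.comp_continuousOn hψ)
  have hT' : ∀ x, T x ∈ Icc (0 : ℝ) 1 := fun x => (height (ψ x)).2
  let l : (Fin n → ℝ) → ℝ := fun x => max 0 (min 1 ((8 * M - ‖x‖) / M))
  have hl : Continuous l := by fun_prop
  have hl' : ∀ x, l x ∈ Icc (0 : ℝ) 1 := fun x =>
    ⟨le_max_left _ _, max_le zero_le_one (min_le_left _ _)⟩
  have hl_one : ∀ x, ‖x‖ ≤ 7 * M → l x = 1 := fun x hx => by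
    have : 1 ≤ (8 * M - ‖x‖) / M := (one_le_div hM).2 (by linarith)
    simp only [l, min_eq_left this, max_eq_right zero_le_one]
  have hl_zero : ∀ x, ‖x‖ = 8 * M → l x = 0 := fun x hx => by
    simp [l, hx]
  let μ : (Fin n → ℝ) → ℝ := fun x => max 0 (min 1 ((‖x‖ - 6 * M) / M))
  have hμ : Continuous μ := by fun_prop
  have hμ' : ∀ x, μ x ∈ Icc (0 : ℝ) 1 := fun x =>
    ⟨le_max_left _ _, max_le zero_le_one (min_le_left _ _)⟩
  have hμ_one : ∀ x, 7 * M ≤ ‖x‖ → μ x = 1 := fun x hx => by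
    have : 1 ≤ (‖x‖ - 6 * M) / M := (one_le_div hM).2 (by linarith)
    simp only [μ, min_eq_left this, max_eq_right zero_le_one]
  have hμ_zero : ∀ x, ‖x‖ ≤ 6 * M → μ x = 0 := fun x hx => by
    have : (‖x‖ - 6 * M) / M ≤ 0 := div_nonpos_of_nonpos_of_nonneg (by linarith) hM.le
    exact max_eq_left ((min_le_right _ _).trans this)
  have hdist : ∀ i, Continuous fun x : Fin n → ℝ => distHalf (x i) := fun i =>
    continuous_distHalf.comp (continuous_apply i)
  let P : Set (Fin n → ℝ) :=
    {x | a + 1 ≤ (Finset.univ.filter fun i => x ∈ {x | distHalf (x i) ≤ 1 / 8}).card}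
  let Q : Set (Fin n → ℝ) :=
    {x | b + 1 ≤ (Finset.univ.filter fun i => x ∈ {x | 3 / 8 ≤ distHalf (x i)}).card}
  have hP : IsClosed P := isClosed_card_le (fun i => isClosed_le (hdist i) continuous_const) _
  have hQ : IsClosed Q := isClosed_card_le (fun i => isClosed_le continuous_const (hdist i)) _
  have hQP : Disjoint Q P := by
    rw [Set.disjoint_left]
    intro x (hxQ : b + 1 ≤ _) (hxP : a + 1 ≤ _)
    have hd : Disjoint (Finset.univ.filter fun i => x ∈ {x : Fin n → ℝ | distHalf (x i) ≤ 1 / 8})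
        (Finset.univ.filter fun i => x ∈ {x : Fin n → ℝ | 3 / 8 ≤ distHalf (x i)}) := by
      refine Finset.disjoint_filter.2 fun i _ h₁ h₂ => ?_
      rw [mem_ofPred_eq] at h₁ h₂
      linarith
    have h := Finset.card_le_univ (Finset.disjUnion _ _ hd)
    rw [Finset.card_disjUnion, Fintype.card_fin] at h
    omega
  obtain ⟨g, hgQ, hgP, -⟩ := exists_continuous_zero_one_of_isClosed hQ hP hQP
  let τ : (Fin n → ℝ) → ℝ := fun x => (1 - μ x) * g x + μ x * T x
  have hτ : Continuous τ := by
    rw [← continuousOn_univ]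
    refine ContinuousOn.of_closed_cover (C := {x | ‖x‖ ≤ 6 * M}) (D := {x | 6 * M ≤ ‖x‖})
      (isClosed_le continuous_norm continuous_const) (isClosed_le continuous_const continuous_norm)
      (fun x _ => le_total ‖x‖ (6 * M)) ?_ ?_
    · refine g.continuous.continuousOn.congr fun x hx => ?_
      simp [τ, hμ_zero x hx.2]
    · refine ((continuous_const.sub hμ).mul g.continuous).continuousOn.add
        (hμ.continuousOn.mul (hT.mono fun x hx => ?_))
      exact norm_pos_iff.1 (lt_of_lt_of_le (by positivity) hx.2)
  have hτT : ∀ x, 7 * M ≤ ‖x‖ → τ x = T x := fun x hx => by simp [τ, hμ_one x hx]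
  have hball : ∀ x y, 6 * M ≤ ‖x‖ → y ∈ closedBall x 1 → y ≠ 0 ∧ |T y - T x| < 1 / 3 := hMT
  obtain ⟨F, hF, hFψ⟩ := exists_extension_near_skeleton hY
    (U := {x | x ≠ 0 ∧ height (ψ x) ≠ 1}) (f := fun x => left (ψ x))
    (continuousOn_left.comp (hψ.mono fun x hx => hx.1) fun x hx => hx.2) (fun _ => 0) hl hl'
  obtain ⟨G, hG, hGψ⟩ := exists_extension_near_skeleton hZ
    (U := {x | x ≠ 0 ∧ height (ψ x) ≠ 0}) (f := fun x => right (ψ x))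
    (continuousOn_right.comp (hψ.mono fun x hx => hx.1) fun x hx => hx.2) (fun _ => 1 / 2) hl hl'
  have hFU : ∀ x, 6 * M ≤ ‖x‖ → T x ≤ 2 / 3 →
      closedBall x 1 ⊆ {x | x ≠ 0 ∧ height (ψ x) ≠ 1} := fun x hx hTx y hy => by
    obtain ⟨h₁, h₂⟩ := hball x y hx hy
    refine ⟨h₁, fun h₃ => ?_⟩
    have h₄ : T y = 1 := by simp [T, h₃]
    rw [h₄, abs_lt] at h₂
    linarith
  have hGU : ∀ x, 6 * M ≤ ‖x‖ → 1 / 3 ≤ T x →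
      closedBall x 1 ⊆ {x | x ≠ 0 ∧ height (ψ x) ≠ 0} := fun x hx hTx y hy => by
    obtain ⟨h₁, h₂⟩ := hball x y hx hy
    refine ⟨h₁, fun h₃ => ?_⟩
    have h₄ : T y = 0 := by simp [T, h₃]
    rw [h₄, abs_lt] at h₂
    linarith
  have hΨ : Continuous fun x => mk (F x) (G x) (stretch (τ x)) := by
    rw [← continuousOn_univ]
    refine continuousOn_mk_stretch isClosed_univ hτ.continuousOn
      (hF.mono fun x hx => ?_) (hG.mono fun x hx => ?_)
    · have hx : τ x ≤ 2 / 3 := hx.2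
      rcases le_total (7 * M) ‖x‖ with h₇ | h₇
      · exact Or.inr (hFU x (by linarith) (hτT x h₇ ▸ hx))
      by_cases hc : (Finset.univ.filter fun i => distHalf (x i + 0) < 1 / 8).card ≤ a
      · exact Or.inl ⟨hl_one x h₇, hc⟩
      have hxP : x ∈ P := (Nat.lt_of_not_le hc).trans_le <| Finset.card_le_card fun i hi => by
        simp only [Finset.mem_filter, Finset.mem_univ, true_and, mem_ofPred_eq, add_zero] at hi ⊢
        exact hi.le
      have hgx : g x = 1 := hgP hxP
      simp only [τ, hgx] at hx
      refine Or.inr (hFU x ?_ ?_)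
      · by_contra! h₆
        rw [hμ_zero x h₆.le] at hx
        linarith
      · nlinarith [mul_nonneg (sub_nonneg.2 (hμ' x).2) (sub_nonneg.2 (hT' x).2)]
    · have hx : 1 / 3 ≤ τ x := hx.2
      rcases le_total (7 * M) ‖x‖ with h₇ | h₇
      · exact Or.inr (hGU x (by linarith) (hτT x h₇ ▸ hx))
      by_cases hc : (Finset.univ.filter fun i => distHalf (x i + 1 / 2) < 1 / 8).card ≤ b
      · exact Or.inl ⟨hl_one x h₇, hc⟩
      have hxQ : x ∈ Q := (Nat.lt_of_not_le hc).trans_le <| Finset.card_le_card fun i hi => by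
        simp only [Finset.mem_filter, Finset.mem_univ, true_and, mem_ofPred_eq] at hi ⊢
        exact le_distHalf_of_distHalf_add_half_lt hi
      have hgx : g x = 0 := hgQ hxQ
      simp only [τ, hgx] at hx
      refine Or.inr (hGU x ?_ ?_)
      · by_contra! h₆
        rw [hμ_zero x h₆.le] at hx
        linarith
      · nlinarith [mul_nonneg (sub_nonneg.2 (hμ' x).2) (hT' x).1]
  obtain ⟨Φ, hΦ, hΦφ⟩ := exists_extension_of_homotopy
    (H := fun x : (Fin n → ℝ) × ℝ => stretchMap (φ x.1) x.2)
    (Φ' := fun v => mk (F ((8 * M) • v)) (G ((8 * M) • v)) (stretch (τ ((8 * M) • v))))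
    (continuous_stretchMap.comp_continuousOn
      ((hφ.comp continuousOn_fst fun x hx => hx.1).prodMk continuousOn_snd))
    (hΨ.comp (continuous_const_smul (8 * M))).continuousOn fun v hv => by
      have hv1 : ‖v‖ = 1 := mem_sphere_zero_iff_norm.1 hv
      have hnorm : ‖(8 * M) • v‖ = 8 * M := by
        rw [norm_smul, hv1, mul_one, Real.norm_of_nonneg (by positivity)]
      have hψv : ψ ((8 * M) • v) = φ v := by
        simp only [ψ, hnorm]
        rw [inv_smul_smul₀ (by positivity)]
      have hτv : τ ((8 * M) • v) = height (φ v) := by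
        rw [hτT _ (by linarith), ← hψv]
      rw [hτv]
      refine mk_stretch_eq_stretchMap (fun h => ?_) fun h => ?_
      · rw [← hψv] at h ⊢
        exact hFψ _ (hl_zero _ hnorm) (hFU _ (by linarith) h)
      · rw [← hψv] at h ⊢
        exact hGψ _ (hl_zero _ hnorm) (hGU _ (by linarith) h)
  exact ⟨Φ, hΦ, fun v hv => (hΦφ v hv).trans (stretchMap_zero _)⟩

/-- if `Y` is `p`-connected and `Z` is `q`-connected (both
nonempty), then the join `Y ∗ Z` is `(p+q+2)`-connected. -/
theorem stmt_7 (Y Z : Type*) [TopologicalSpace Y] [TopologicalSpace Z]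
    [Nonempty Y] [Nonempty Z] (p q : ℕ)
    (hY : NConnected p Y) (hZ : NConnected q Z) :
    NConnected (p + q + 2) (Join Y Z) := by
  have : Nonempty (Join Y Z) := ⟨Join.mk (Classical.arbitrary Y) (Classical.arbitrary Z) 0⟩
  exact nConnected_of_extendsOver fun k hk =>
    Join.extendsOver (fun j hj => hY.extendsOver hj) (fun j hj => hZ.extendsOver hj)
      (show k + 1 ≤ (p + 1) + (q + 1) + 1 by omega)
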